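/- For all τ in the complex upper half-plane ℍ and all z ∈ ℂ, one has (1/12)·φ_{0,1}(τ,z) − Λ_2(τ/2 + 1/2)·φ_{-2,1}(τ,z) = ϑ_3(τ,z)²/ϑ_3(τ,0)². -/

import Mathlib

noncomputable section

open Complex

/-- `2πi`. -/
def twoPiI : ℂ := 2 * Real.pi * Complex.I

/-- `q = e^{2πiτ}`. -/
def qq (τ : ℂ) : ℂ := Complex.exp (twoPiI * τ)

/-- `y = e^{2πiz}`. -/
def yy (z : ℂ) : ℂ := Complex.exp (twoPiI * z)

/-- Jacobi theta function `ϑ₁`. -/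
def th1 (τ z : ℂ) : ℂ :=
  -Complex.I * ∑' n : ℤ, (-1 : ℂ) ^ n *
    Complex.exp (twoPiI * (((n : ℂ) + 1/2) * z + ((n : ℂ) + 1/2) ^ 2 / 2 * τ))

/-- Jacobi theta function `ϑ₂`. -/
def th2 (τ z : ℂ) : ℂ :=
  ∑' n : ℤ, Complex.exp (twoPiI * (((n : ℂ) + 1/2) * z + ((n : ℂ) + 1/2) ^ 2 / 2 * τ))

/-- Jacobi theta function `ϑ₃`. -/
def th3 (τ z : ℂ) : ℂ :=
  ∑' n : ℤ, Complex.exp (twoPiI * ((n : ℂ) * z + (n : ℂ) ^ 2 / 2 * τ))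

/-- Jacobi theta function `ϑ₄`. -/
def th4 (τ z : ℂ) : ℂ :=
  ∑' n : ℤ, (-1 : ℂ) ^ n * Complex.exp (twoPiI * ((n : ℂ) * z + (n : ℂ) ^ 2 / 2 * τ))

/-- The Dedekind eta function `η(τ) = q^{1/24} ∏_{n≥1} (1 - qⁿ)`. -/
def etaF (τ : ℂ) : ℂ :=
  Complex.exp (twoPiI * τ / 24) * ∏' n : ℕ, (1 - qq τ ^ (n + 1))

/-- The quasimodular Eisenstein series `E₂(τ) = 1 - 24 ∑_{n≥1} σ₁(n) qⁿ`. -/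
def E2 (τ : ℂ) : ℂ :=
  1 - 24 * ∑' n : ℕ, (∑ d ∈ Nat.divisors (n + 1), (d : ℂ)) * qq τ ^ (n + 1)

/-- `Λ_N(τ) = (N/24)(N E₂(Nτ) - E₂(τ))`. -/
def Lam (N : ℕ) (τ : ℂ) : ℂ := (N : ℂ) / 24 * ((N : ℂ) * E2 ((N : ℂ) * τ) - E2 τ)

/-- The weak Jacobi form `φ_{0,1}`. -/
def phi01 (τ z : ℂ) : ℂ :=
  4 * (th2 τ z ^ 2 / th2 τ 0 ^ 2 + th3 τ z ^ 2 / th3 τ 0 ^ 2 + th4 τ z ^ 2 / th4 τ 0 ^ 2)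

/-- The weak Jacobi form `φ_{-2,1}`. -/
def phim21 (τ z : ℂ) : ℂ := -(th1 τ z ^ 2) / etaF τ ^ 6

section Auxiliary

/-! ### Theta functions -/

theorem th3_eq_jacobiTheta₂ (τ z : ℂ) : th3 τ z = jacobiTheta₂ z τ := by
  unfold th3 jacobiTheta₂ jacobiTheta₂_term twoPiI
  refine tsum_congr fun n ↦ ?_
  congr 1
  ring

theorem cexp_pi_I_mul_int (n : ℤ) : cexp (Real.pi * I * n) = (-1) ^ n := by
  rw [mul_comm, Complex.exp_int_mul, Complex.exp_pi_mul_I]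

theorem th4_eq_th3 (τ z : ℂ) : th4 τ z = th3 τ (z + 1 / 2) := by
  unfold th3 th4 twoPiI
  refine tsum_congr fun n ↦ ?_
  rw [← cexp_pi_I_mul_int, ← Complex.exp_add]
  congr 1
  ring

theorem th2_eq_th3 (τ z : ℂ) :
    th2 τ z = cexp (Real.pi * I * (z + τ / 4)) * th3 τ (z + τ / 2) := by
  unfold th2 th3 twoPiI
  rw [← tsum_mul_left]
  refine tsum_congr fun n ↦ ?_
  rw [← Complex.exp_add]
  congr 1
  ring

theorem th1_eq_th2 (τ z : ℂ) : th1 τ z = -th2 τ (z + 1 / 2) := by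
  unfold th1 th2 twoPiI
  rw [← tsum_mul_left, ← tsum_neg]
  refine tsum_congr fun n ↦ ?_
  have h : cexp (2 * Real.pi * I * ((n + 1 / 2) * (z + 1 / 2) + (n + 1 / 2) ^ 2 / 2 * τ)) =
      cexp (Real.pi * I * n) * cexp (Real.pi / 2 * I) *
        cexp (2 * Real.pi * I * ((n + 1 / 2) * z + (n + 1 / 2) ^ 2 / 2 * τ)) := by
    rw [← Complex.exp_add, ← Complex.exp_add]
    congr 1
    ring
  rw [h, cexp_pi_I_mul_int, Complex.exp_pi_div_two_mul_I]
  ring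

theorem th3_add_one (τ z : ℂ) : th3 τ (z + 1) = th3 τ z := by
  simp only [th3_eq_jacobiTheta₂, jacobiTheta₂_add_left]

theorem th2_add_one (τ z : ℂ) : th2 τ (z + 1) = -th2 τ z := by
  rw [th2_eq_th3, th2_eq_th3, show z + 1 + τ / 2 = z + τ / 2 + 1 by ring, th3_add_one,
    show Real.pi * I * (z + 1 + τ / 4) = Real.pi * I * (z + τ / 4) + Real.pi * I by ring,
    Complex.exp_add, Complex.exp_pi_mul_I]
  ring

theorem th3_add_half_period (τ z : ℂ) :
    th3 τ (z + τ / 2) = cexp (-(Real.pi * I * (z + τ / 4))) * th2 τ z := by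
  rw [th2_eq_th3, ← mul_assoc, ← Complex.exp_add, neg_add_cancel, Complex.exp_zero, one_mul]

theorem th2_add_half_period (τ z : ℂ) :
    th2 τ (z + τ / 2) = cexp (-(Real.pi * I * (z + τ / 4))) * th3 τ z := by
  rw [th2_eq_th3, show z + τ / 2 + τ / 2 = z + τ by ring, th3_eq_jacobiTheta₂,
    jacobiTheta₂_add_left', th3_eq_jacobiTheta₂, ← mul_assoc, ← Complex.exp_add]
  congr 2
  ring

theorem summable_th3 {τ : ℂ} (hτ : 0 < τ.im) (z : ℂ) :
    Summable fun n : ℤ ↦ cexp (twoPiI * ((n : ℂ) * z + (n : ℂ) ^ 2 / 2 * τ)) := by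
  convert (summable_jacobiTheta₂_term_iff z τ).mpr hτ using 2 with n
  unfold jacobiTheta₂_term twoPiI
  ring_nf

theorem summable_th2 {τ : ℂ} (hτ : 0 < τ.im) (z : ℂ) :
    Summable fun n : ℤ ↦
      cexp (twoPiI * (((n : ℂ) + 1 / 2) * z + ((n : ℂ) + 1 / 2) ^ 2 / 2 * τ)) := by
  refine ((summable_th3 hτ (z + τ / 2)).mul_left (cexp (Real.pi * I * (z + τ / 4)))).congr
    fun n ↦ ?_
  rw [← Complex.exp_add]
  unfold twoPiI
  ring_nf

/-- Pairs of integers, split according to the parity of their sum. -/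
def intPairParity : (ℤ × ℤ) ⊕ (ℤ × ℤ) → ℤ × ℤ :=
  Sum.elim (fun p ↦ (p.1 + p.2, p.1 - p.2)) (fun p ↦ (p.1 + p.2 + 1, p.1 - p.2))

theorem intPairParity_bijective : Function.Bijective intPairParity := by
  constructor
  · rintro (⟨a, b⟩ | ⟨a, b⟩) (⟨c, d⟩ | ⟨c, d⟩) h <;>
      simp only [intPairParity, Sum.elim_inl, Sum.elim_inr, Prod.mk.injEq] at h <;>
      simp only [Sum.inl.injEq, Sum.inr.injEq, Prod.mk.injEq, reduceCtorEq] <;> omega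
  · rintro ⟨m, n⟩
    rcases Int.even_or_odd' (m + n) with ⟨k, h | h⟩
    · exact ⟨Sum.inl (k, m - k), by simp [intPairParity]; omega⟩
    · exact ⟨Sum.inr (k, m - k - 1), by simp [intPairParity]; omega⟩

theorem hasSum_mul_of_summable {f g : ℤ → ℂ} (hf : Summable f) (hg : Summable g) :
    HasSum (fun p : ℤ × ℤ ↦ f p.1 * g p.2) ((∑' n, f n) * ∑' n, g n) :=
  hf.hasSum.mul hg.hasSum (summable_mul_of_summable_norm hf.norm hg.norm)

theorem th3_sq {τ : ℂ} (hτ : 0 < τ.im) (z : ℂ) :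
    th3 τ z ^ 2 =
      th3 (2 * τ) (2 * z) * th3 (2 * τ) 0 + th2 (2 * τ) (2 * z) * th2 (2 * τ) 0 := by
  have hτ' : 0 < (2 * τ).im := by simpa using hτ
  have h := hasSum_mul_of_summable (summable_th3 hτ z) (summable_th3 hτ z)
  rw [← (Equiv.ofBijective _ intPairParity_bijective).hasSum_iff] at h
  rw [sq]
  refine h.unique (HasSum.sum ?_ ?_)
  · refine (hasSum_mul_of_summable (summable_th3 hτ' (2 * z)) (summable_th3 hτ' 0)).congr_fun
      fun p ↦ ?_
    simp only [Function.comp, Equiv.ofBijective_apply, intPairParity, Sum.elim_inl]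
    rw [← Complex.exp_add, ← Complex.exp_add]
    push_cast
    ring_nf
  · refine (hasSum_mul_of_summable (summable_th2 hτ' (2 * z)) (summable_th2 hτ' 0)).congr_fun
      fun p ↦ ?_
    simp only [Function.comp, Equiv.ofBijective_apply, intPairParity, Sum.elim_inr]
    rw [← Complex.exp_add, ← Complex.exp_add]
    push_cast
    ring_nf

theorem th4_sq {τ : ℂ} (hτ : 0 < τ.im) (z : ℂ) :
    th4 τ z ^ 2 =
      th3 (2 * τ) (2 * z) * th3 (2 * τ) 0 - th2 (2 * τ) (2 * z) * th2 (2 * τ) 0 := by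
  rw [th4_eq_th3, th3_sq hτ, show 2 * (z + 1 / 2) = 2 * z + 1 by ring, th3_add_one, th2_add_one]
  ring

theorem th2_sq {τ : ℂ} (hτ : 0 < τ.im) (z : ℂ) :
    th2 τ z ^ 2 =
      th2 (2 * τ) (2 * z) * th3 (2 * τ) 0 + th3 (2 * τ) (2 * z) * th2 (2 * τ) 0 := by
  have h : cexp (Real.pi * I * (z + τ / 4)) ^ 2 *
      cexp (-(Real.pi * I * (2 * z + 2 * τ / 4))) = 1 := by
    rw [← Complex.exp_nat_mul, ← Complex.exp_add, ← Complex.exp_zero]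
    congr 1
    push_cast
    ring
  rw [th2_eq_th3, mul_pow, th3_sq hτ, show 2 * (z + τ / 2) = 2 * z + 2 * τ / 2 by ring,
    th3_add_half_period, th2_add_half_period]
  linear_combination (th2 (2 * τ) (2 * z) * th3 (2 * τ) 0 +
    th3 (2 * τ) (2 * z) * th2 (2 * τ) 0) * h

theorem th1_sq {τ : ℂ} (hτ : 0 < τ.im) (z : ℂ) :
    th1 τ z ^ 2 =
      th3 (2 * τ) (2 * z) * th2 (2 * τ) 0 - th2 (2 * τ) (2 * z) * th3 (2 * τ) 0 := by
  rw [th1_eq_th2, neg_sq, th2_sq hτ, show 2 * (z + 1 / 2) = 2 * z + 1 by ring, th3_add_one,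
    th2_add_one]
  ring

theorem th3_zero_pow_four {τ : ℂ} (hτ : 0 < τ.im) :
    th3 τ 0 ^ 4 = th2 τ 0 ^ 4 + th4 τ 0 ^ 4 := by
  have h2 := th2_sq hτ 0
  have h3 := th3_sq hτ 0
  have h4 := th4_sq hτ 0
  rw [mul_zero] at h2 h3 h4
  rw [show th3 τ 0 ^ 4 = (th3 τ 0 ^ 2) ^ 2 by ring, show th2 τ 0 ^ 4 = (th2 τ 0 ^ 2) ^ 2 by ring,
    show th4 τ 0 ^ 4 = (th4 τ 0 ^ 2) ^ 2 by ring, h2, h3, h4]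
  ring

/-- The identity, given the values of `Λ₂` and `η⁶` in terms of theta constants. -/
theorem theta3_identity_of_theta_constants {τ : ℂ} (hτ : 0 < τ.im) (z : ℂ)
    (h2 : th2 τ 0 ≠ 0) (h3 : th3 τ 0 ≠ 0) (h4 : th4 τ 0 ≠ 0)
    (hΛ : Lam 2 (τ / 2 + 1 / 2) = (th4 τ 0 ^ 4 - th2 τ 0 ^ 4) / 12)
    (hη : (th2 τ 0 * th3 τ 0 * th4 τ 0) ^ 2 = 4 * etaF τ ^ 6) :
    1 / 12 * phi01 τ z - Lam 2 (τ / 2 + 1 / 2) * phim21 τ z = th3 τ z ^ 2 / th3 τ 0 ^ 2 := by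
  have hη' : etaF τ ^ 6 = th2 τ 0 ^ 2 * th3 τ 0 ^ 2 * th4 τ 0 ^ 2 / 4 := by
    linear_combination -hη / 4
  have h2' := th2_sq hτ 0
  have h3' := th3_sq hτ 0
  have h4' := th4_sq hτ 0
  rw [mul_zero] at h2' h3' h4'
  unfold phi01 phim21
  rw [hΛ, hη', th2_sq hτ z, th3_sq hτ z, th4_sq hτ z, th1_sq hτ z]
  generalize th3 (2 * τ) (2 * z) = P at *
  generalize th2 (2 * τ) (2 * z) = Q at *
  generalize th3 (2 * τ) 0 = p at *
  generalize th2 (2 * τ) 0 = r at *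
  generalize th2 τ 0 = a at *
  generalize th3 τ 0 = b at *
  generalize th4 τ 0 = c at *
  rw [show c ^ 4 = (c ^ 2) ^ 2 by ring, show a ^ 4 = (a ^ 2) ^ 2 by ring]
  replace h2 := pow_ne_zero 2 h2
  replace h3 := pow_ne_zero 2 h3
  replace h4 := pow_ne_zero 2 h4
  generalize a ^ 2 = A at *
  generalize b ^ 2 = B at *
  generalize c ^ 2 = C at *
  field_simp
  subst h2' h3' h4'
  ring

/-! ### Modular behaviour of the theta constants -/

theorem cpow_neg_I_mul_pow_four (τ : ℂ) : ((-I * τ) ^ (1 / 2 : ℂ)) ^ 4 = -τ ^ 2 := by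
  rw [← Complex.cpow_nat_mul, show ((4 : ℕ) : ℂ) * (1 / 2) = ((2 : ℕ) : ℂ) by norm_num,
    Complex.cpow_natCast, mul_pow, neg_sq, I_sq]
  ring

theorem im_neg_one_div_pos {τ : ℂ} (hτ : 0 < τ.im) : 0 < (-1 / τ).im := by
  have h0 : τ ≠ 0 := by rintro rfl; simp at hτ
  rw [neg_div, neg_im, one_div, inv_im, neg_div, neg_neg]
  exact div_pos hτ (Complex.normSq_pos.mpr h0)

theorem th3_zero_add_one (τ : ℂ) : th3 (τ + 1) 0 = th4 τ 0 := by
  unfold th3 th4 twoPiI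
  refine tsum_congr fun n ↦ ?_
  have h : ((-1 : ℂ) ^ n) = cexp (Real.pi * I * ((n ^ 2 : ℤ) : ℂ)) := by
    rw [cexp_pi_I_mul_int]
    rcases Int.even_or_odd n with hn | hn
    · rw [hn.neg_one_zpow, (hn.pow_of_ne_zero two_ne_zero).neg_one_zpow]
    · rw [hn.neg_one_zpow, (hn.pow).neg_one_zpow]
  rw [h, ← Complex.exp_add]
  push_cast
  congr 1
  ring

theorem th4_zero_add_one (τ : ℂ) : th4 (τ + 1) 0 = th3 τ 0 := by
  rw [← th3_zero_add_one, th3_eq_jacobiTheta₂, th3_eq_jacobiTheta₂, add_assoc, one_add_one_eq_two,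
    jacobiTheta₂_add_right]

theorem th2_zero_add_one_pow_four {τ : ℂ} (hτ : 0 < τ.im) :
    th2 (τ + 1) 0 ^ 4 = -th2 τ 0 ^ 4 := by
  have h := th3_zero_pow_four hτ
  have h' := th3_zero_pow_four (τ := τ + 1) (by simpa using hτ)
  rw [th3_zero_add_one, th4_zero_add_one] at h'
  linear_combination -h' - h

theorem th3_zero_S_pow_four {τ : ℂ} (hτ : 0 < τ.im) :
    th3 (-1 / τ) 0 ^ 4 = -τ ^ 2 * th3 τ 0 ^ 4 := by
  have h0 : τ ≠ 0 := by rintro rfl; simp at hτ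
  have h := jacobiTheta₂_functional_equation 0 τ
  rw [zero_div, ← th3_eq_jacobiTheta₂, ← th3_eq_jacobiTheta₂] at h
  rw [h, mul_pow, mul_pow, div_pow, cpow_neg_I_mul_pow_four]
  have : -τ ^ 2 ≠ 0 := by simpa using h0
  simp
  field_simp

theorem th4_zero_S_pow_four {τ : ℂ} (hτ : 0 < τ.im) :
    th4 (-1 / τ) 0 ^ 4 = -τ ^ 2 * th2 τ 0 ^ 4 := by
  have h0 : τ ≠ 0 := by rintro rfl; simp at hτ
  have h := jacobiTheta₂_functional_equation (τ / 2) τ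
  rw [show τ / 2 / τ = 0 + 1 / 2 by field_simp; simp, ← th3_eq_jacobiTheta₂,
    ← th3_eq_jacobiTheta₂, ← th4_eq_th3] at h
  have he : cexp (Real.pi * I * (0 + τ / 4)) * cexp (-Real.pi * I * (τ / 2) ^ 2 / τ) = 1 := by
    rw [← Complex.exp_add, ← Complex.exp_zero]
    congr 1
    field_simp
    ring
  have h2 : th2 τ 0 = 1 / (-I * τ) ^ (1 / 2 : ℂ) * th4 (-1 / τ) 0 := by
    rw [th2_eq_th3, zero_add (τ / 2), h]
    linear_combination (1 / (-I * τ) ^ (1 / 2 : ℂ) * th4 (-1 / τ) 0) * he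
  rw [h2, mul_pow, div_pow, cpow_neg_I_mul_pow_four]
  field_simp

theorem th2_zero_S_pow_four {τ : ℂ} (hτ : 0 < τ.im) :
    th2 (-1 / τ) 0 ^ 4 = -τ ^ 2 * th4 τ 0 ^ 4 := by
  have h := th3_zero_pow_four hτ
  have h' := th3_zero_pow_four (im_neg_one_div_pos hτ)
  rw [th3_zero_S_pow_four hτ, th4_zero_S_pow_four hτ] at h'
  linear_combination -h' - τ ^ 2 * h

theorem differentiableAt_th3_zero {τ : ℂ} (hτ : 0 < τ.im) :
    DifferentiableAt ℂ (fun τ ↦ th3 τ 0) τ := by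
  simp only [th3_eq_jacobiTheta₂]
  exact differentiableAt_jacobiTheta₂_snd 0 hτ

theorem differentiableAt_th4_zero {τ : ℂ} (hτ : 0 < τ.im) :
    DifferentiableAt ℂ (fun τ ↦ th4 τ 0) τ := by
  simp only [th4_eq_th3, th3_eq_jacobiTheta₂]
  exact differentiableAt_jacobiTheta₂_snd _ hτ

theorem differentiableAt_th2_zero {τ : ℂ} (hτ : 0 < τ.im) :
    DifferentiableAt ℂ (fun τ ↦ th2 τ 0) τ := by
  simp only [th2_eq_th3, th3_eq_jacobiTheta₂]
  refine DifferentiableAt.mul (by fun_prop) ?_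
  exact (hasFDerivAt_jacobiTheta₂ (0 + τ / 2) hτ).differentiableAt.comp τ
    (f := fun t : ℂ ↦ (0 + t / 2, t)) (by fun_prop)

/-! ### Behaviour at `i∞` -/

open Filter Topology

/-- The filter of complex numbers with imaginary part tending to `+∞`. -/
def imInfty : Filter ℂ := comap Complex.im atTop

theorem tendsto_coe_imInfty : Tendsto ((↑) : UpperHalfPlane → ℂ) UpperHalfPlane.atImInfty imInfty :=
  tendsto_comap_iff.mpr tendsto_comap

instance : imInfty.NeBot := tendsto_coe_imInfty.neBot

theorem tendsto_imInfty_iff {f : ℂ → ℂ} :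
    Tendsto f imInfty imInfty ↔ Tendsto (fun τ ↦ (f τ).im) imInfty atTop :=
  tendsto_comap_iff

theorem tendsto_im_imInfty : Tendsto Complex.im imInfty atTop := tendsto_comap

theorem tendsto_add_one_imInfty : Tendsto (fun τ : ℂ ↦ τ + 1) imInfty imInfty := by
  simpa [tendsto_imInfty_iff] using tendsto_im_imInfty

theorem tendsto_two_mul_imInfty : Tendsto (fun τ : ℂ ↦ 2 * τ) imInfty imInfty := by
  simpa [tendsto_imInfty_iff] using tendsto_im_imInfty.const_mul_atTop two_pos

theorem tendsto_div_two_imInfty : Tendsto (fun τ : ℂ ↦ τ / 2) imInfty imInfty := by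
  simpa [tendsto_imInfty_iff] using tendsto_im_imInfty.atTop_div_const two_pos

theorem eventually_one_le_im : ∀ᶠ τ in imInfty, 1 ≤ τ.im :=
  tendsto_im_imInfty.eventually_ge_atTop 1

theorem norm_cexp_pi_I_mul (c : ℝ) (τ : ℂ) :
    ‖cexp (Real.pi * I * c * τ)‖ = Real.exp (-(Real.pi * c * τ.im)) := by
  rw [Complex.norm_exp]
  congr 1
  simp [mul_assoc, Complex.mul_re]

theorem tendsto_cexp_imInfty {c : ℝ} (hc : 0 < c) :
    Tendsto (fun τ ↦ cexp (Real.pi * I * c * τ)) imInfty (𝓝 0) := by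
  rw [tendsto_zero_iff_norm_tendsto_zero]
  simp only [norm_cexp_pi_I_mul]
  exact Real.tendsto_exp_neg_atTop_nhds_zero.comp
    (tendsto_im_imInfty.const_mul_atTop (by positivity))

theorem norm_cexp_pi_I_mul_le {c : ℝ} (hc : 0 ≤ c) {τ : ℂ} (hτ : 1 ≤ τ.im) :
    ‖cexp (Real.pi * I * c * τ)‖ ≤ ‖cexp (Real.pi * I * c * I)‖ := by
  rw [norm_cexp_pi_I_mul, norm_cexp_pi_I_mul, I_im]
  have : 0 ≤ Real.pi * c := by positivity
  gcongr

/-- Termwise passage to the limit in exponential series with nonnegative exponents. -/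
theorem tendsto_tsum_cexp_imInfty {ι : Type*} (a : ι → ℂ) (c : ι → ℝ) (hc : ∀ i, 0 ≤ c i)
    (hs : Summable fun i ↦ a i * cexp (Real.pi * I * c i * I)) :
    Tendsto (fun τ ↦ ∑' i, a i * cexp (Real.pi * I * c i * τ)) imInfty
      (𝓝 (∑' i, if c i = 0 then a i else 0)) := by
  refine tendsto_tsum_of_dominated_convergence hs.norm (fun i ↦ ?_) ?_
  · split_ifs with h
    · simp [h]
    · simpa using (tendsto_cexp_imInfty (lt_of_le_of_ne (hc i) (Ne.symm h))).const_mul (a i)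
  · filter_upwards [eventually_one_le_im] with τ hτ i
    rw [norm_mul, norm_mul]
    gcongr
    exact norm_cexp_pi_I_mul_le (hc i) hτ

theorem tendsto_th3_imInfty : Tendsto (fun τ ↦ th3 τ 0) imInfty (𝓝 1) := by
  have h := tendsto_tsum_cexp_imInfty (ι := ℤ) (fun _ ↦ 1) (fun n ↦ (n : ℝ) ^ 2)
    (fun n ↦ by positivity) ((summable_th3 (τ := I) (by simp) 0).congr fun n ↦ by
      rw [one_mul]; unfold twoPiI; push_cast; ring_nf)
  convert h using 2
  · unfold th3 twoPiI
    refine tsum_congr fun n ↦ ?_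
    rw [one_mul]; push_cast; ring_nf
  · simp

theorem tendsto_th4_imInfty : Tendsto (fun τ ↦ th4 τ 0) imInfty (𝓝 1) := by
  simp only [← th3_zero_add_one]
  exact tendsto_th3_imInfty.comp tendsto_add_one_imInfty

theorem tendsto_cexp_mul_th2_imInfty :
    Tendsto (fun τ ↦ cexp (-(Real.pi * I * τ / 4)) * th2 τ 0) imInfty (𝓝 2) := by
  have key (τ : ℂ) (n : ℤ) : cexp (-(Real.pi * I * τ / 4)) *
      cexp (twoPiI * (((n : ℂ) + 1 / 2) * 0 + ((n : ℂ) + 1 / 2) ^ 2 / 2 * τ)) =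
      1 * cexp (Real.pi * I * ((n * (n + 1) : ℤ) : ℝ) * τ) := by
    rw [← Complex.exp_add, one_mul]; unfold twoPiI; push_cast; ring_nf
  have h := tendsto_tsum_cexp_imInfty (ι := ℤ) (fun _ ↦ 1) (fun n ↦ ((n * (n + 1) : ℤ) : ℝ))
    (fun n ↦ by
      have : 0 ≤ n * (n + 1) := by
        rcases le_or_gt 0 n with hn | hn
        · positivity
        · exact mul_nonneg_of_nonpos_of_nonpos hn.le (by omega)
      exact_mod_cast this)
    (((summable_th2 (τ := I) (by simp) 0).mul_left (cexp (-(Real.pi * I * I / 4)))).congr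
      fun n ↦ key I n)
  convert h using 2
  · unfold th2
    rw [← tsum_mul_left]
    exact tsum_congr fun n ↦ key _ n
  · rw [tsum_eq_sum (s := {0, -1})]
    · rw [Finset.sum_pair (by decide)]
      norm_num
    · intro n hn
      rw [if_neg]
      simp only [Finset.mem_insert, Finset.mem_singleton, not_or] at hn
      norm_cast
      rw [mul_eq_zero]
      omega

theorem tendsto_th2_pow_four_imInfty : Tendsto (fun τ ↦ th2 τ 0 ^ 4) imInfty (𝓝 0) := by
  have h := (tendsto_th3_imInfty.pow 4).sub (tendsto_th4_imInfty.pow 4)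
  rw [sub_self] at h
  refine h.congr' ?_
  filter_upwards [eventually_one_le_im] with τ hτ
  rw [th3_zero_pow_four (by linarith)]
  ring

/-! ### Eisenstein series of weight two and the eta function -/

theorem E2_eq_eisensteinE2 (τ : UpperHalfPlane) : E2 τ = EisensteinSeries.E2 τ := by
  rw [EisensteinSeries.E2_eq_tsum_cexp, tsum_pnat_eq_tsum_succ (f := fun n : ℕ ↦
    (ArithmeticFunction.sigma 1 n : ℂ) * cexp (2 * Real.pi * I * τ) ^ n)]
  simp [E2, qq, twoPiI, ArithmeticFunction.sigma_one_apply]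

theorem etaF_eq_eta (τ : ℂ) : etaF τ = ModularForm.eta τ := by
  unfold etaF ModularForm.eta qq twoPiI
  simp only [ModularForm.eta_q_eq_pow, Function.Periodic.qParam]
  simp

theorem E2_add_one (τ : ℂ) : E2 (τ + 1) = E2 τ := by
  have : qq (τ + 1) = qq τ := by
    unfold qq twoPiI
    rw [mul_add, Complex.exp_add, mul_one, Complex.exp_two_pi_mul_I, mul_one]
  unfold E2
  rw [this]

theorem E2_S {τ : ℂ} (hτ : 0 < τ.im) :
    E2 (-1 / τ) = τ ^ 2 * E2 τ + 6 / (Real.pi * I) * τ := by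
  have h0 : τ ≠ 0 := by rintro rfl; simp at hτ
  have h := EisensteinSeries.G2_S_transform ⟨τ, hτ⟩
  have h1 := E2_eq_eisensteinE2 ⟨τ, hτ⟩
  have h2 := E2_eq_eisensteinE2 (ModularGroup.S • ⟨τ, hτ⟩)
  rw [UpperHalfPlane.modular_S_smul] at h2 h
  simp only [EisensteinSeries.E2, Pi.smul_apply, smul_eq_mul] at h1 h2
  simp only at h h1 h2
  have h3 : (-τ)⁻¹ = -1 / τ := by rw [neg_div, one_div, inv_neg]
  rw [← h3, h2, h1, h, riemannZeta_two]
  have := Real.pi_ne_zero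
  field_simp
  ring_nf
  simp

theorem differentiableOn_E2 : DifferentiableOn ℂ E2 {τ | 0 < τ.im} := by
  refine (UpperHalfPlane.mdifferentiable_iff.mp E2_mdifferentiable).congr fun z hz ↦ ?_
  rw [Function.comp_apply, UpperHalfPlane.ofComplex_apply_of_im_pos hz]
  exact E2_eq_eisensteinE2 ⟨z, hz⟩

theorem tendsto_E2_imInfty : Tendsto E2 imInfty (𝓝 1) := by
  have key (τ : ℂ) (n : ℕ) : (∑ d ∈ Nat.divisors (n + 1), (d : ℂ)) * qq τ ^ (n + 1) =
      (∑ d ∈ Nat.divisors (n + 1), (d : ℂ)) * cexp (Real.pi * I * ((2 * (n + 1) : ℝ)) * τ) := by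
    unfold qq twoPiI
    rw [← Complex.exp_nat_mul]
    push_cast
    ring_nf
  have h := tendsto_tsum_cexp_imInfty (fun n : ℕ ↦ ∑ d ∈ Nat.divisors (n + 1), (d : ℂ))
    (fun n ↦ 2 * (n + 1)) (fun n ↦ by positivity) ?_
  · simp only [← key] at h
    have h0 : ∑' n : ℕ, (if 2 * ((n : ℝ) + 1) = 0 then ∑ d ∈ Nat.divisors (n + 1), (d : ℂ)
        else 0) = 0 := by
      refine (tsum_congr fun n ↦ if_neg ?_).trans tsum_zero
      positivity
    rw [h0] at h
    have h1 := (h.const_mul 24).const_sub 1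
    rwa [mul_zero, sub_zero] at h1
  · have := (summable_nat_add_iff 1).mpr
      (EisensteinSeries.summable_sigma_mul_cexp_pow (k := 2) one_le_two UpperHalfPlane.I)
    refine this.congr fun n ↦ ?_
    rw [← key, ArithmeticFunction.sigma_one_apply]
    simp [qq, twoPiI]

/-! ### Level one cusp forms -/

open UpperHalfPlane ModularForm MatrixGroups CongruenceSubgroup

theorem exists_cuspForm_levelOne {F : ℂ → ℂ} {k : ℕ}
    (hd : DifferentiableOn ℂ F {τ | 0 < τ.im}) (hT : ∀ τ : ℂ, 0 < τ.im → F (τ + 1) = F τ)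
    (hS : ∀ τ : ℂ, 0 < τ.im → F (-1 / τ) = τ ^ k * F τ) (h0 : Tendsto F imInfty (𝓝 0)) :
    ∃ f : CuspForm 𝒮ℒ k, ∀ τ : ℍ, f τ = F τ := by
  have hS' : (fun τ : ℍ ↦ F τ) ∣[(k : ℤ)] ModularGroup.S = fun τ : ℍ ↦ F τ := by
    ext z
    rw [SL_slash_apply, UpperHalfPlane.modular_S_smul]
    have h := hS z z.2
    have h0 : (z : ℂ) ≠ 0 := z.ne_zero
    rw [neg_div, one_div] at h
    rw [ModularGroup.denom_S, coe_mk, inv_neg, h, zpow_neg, zpow_natCast]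
    field_simp
  have hT' : (fun τ : ℍ ↦ F τ) ∣[(k : ℤ)] ModularGroup.T = fun τ : ℍ ↦ F τ := by
    ext z
    rw [SL_slash_apply, UpperHalfPlane.modular_T_smul]
    have h := hT z z.2
    rw [add_comm] at h
    have h1 : denom (ModularGroup.T : SL(2, ℤ)) z = 1 := by
      rw [ModularGroup.denom_apply]
      simp [ModularGroup.T]
    simpa [h1]
  refine ⟨⟨⟨fun τ ↦ F τ, ?_⟩, ?_, ?_⟩, fun _ ↦ rfl⟩
  · rintro A ⟨A, rfl⟩
    exact SlashInvariantForm.slash_action_generators_SL2Z hS' hT' A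
  · rw [UpperHalfPlane.mdifferentiable_iff]
    refine hd.congr fun z hz ↦ ?_
    simp [ofComplex_apply_of_im_pos hz]
  · intro c hc
    rw [Subgroup.IsArithmetic.isCusp_iff_isCusp_SL2Z] at hc
    rw [OnePoint.isZeroAt_iff_forall_SL2Z hc]
    intro γ _
    change IsZeroAtImInfty ((fun τ : ℍ ↦ F τ) ∣[(k : ℤ)] γ)
    rw [SlashInvariantForm.slash_action_generators_SL2Z hS' hT']
    exact h0.comp tendsto_coe_imInfty

theorem eqOn_zero_or_eqOn_zero_of_mul {f g : ℂ → ℂ} (hf : DifferentiableOn ℂ f {τ | 0 < τ.im})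
    (hg : DifferentiableOn ℂ g {τ | 0 < τ.im}) (h : ∀ τ : ℂ, 0 < τ.im → f τ * g τ = 0) :
    (∀ τ : ℂ, 0 < τ.im → f τ = 0) ∨ ∀ τ : ℂ, 0 < τ.im → g τ = 0 :=
  AnalyticOnNhd.eq_zero_or_eq_zero_of_mul_eq_zero (hf.analyticOnNhd isOpen_upperHalfPlaneSet)
    (hg.analyticOnNhd isOpen_upperHalfPlaneSet) h
    (Convex.isPreconnected (convex_halfSpace_im_gt 0))

/-! ### The product of the theta constants -/

theorem tendsto_cexp_mul_etaF_imInfty :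
    Tendsto (fun τ ↦ cexp (-(twoPiI * τ / 24)) * etaF τ) imInfty (𝓝 1) := by
  have hq : Tendsto qq imInfty (𝓝 0) := by
    refine (tendsto_cexp_imInfty two_pos).congr fun τ ↦ ?_
    unfold qq twoPiI
    push_cast
    ring_nf
  have hc : ContinuousAt (fun q : ℂ ↦ ∏' n : ℕ, (1 - q ^ (n + 1))) 0 :=
    (differentiableOn_tprod_one_sub_pow.differentiableAt
      (Metric.ball_mem_nhds 0 one_pos)).continuousAt
  have h := hc.tendsto.comp hq
  simp only [ne_eq, Nat.add_eq_zero_iff, one_ne_zero, and_false, not_false_eq_true, zero_pow,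
    sub_zero, tprod_one] at h
  refine h.congr fun τ ↦ ?_
  unfold etaF
  rw [← mul_assoc, ← Complex.exp_add, neg_add_cancel, Complex.exp_zero, one_mul]
  rfl

theorem etaF_ne_zero {τ : ℂ} (hτ : 0 < τ.im) : etaF τ ≠ 0 := by
  rw [etaF_eq_eta]
  exact ModularForm.eta_ne_zero hτ

theorem exists_theta_prod_pow_eq :
    ∃ K : ℂ, ∀ τ : ℂ, 0 < τ.im → (th2 τ 0 * th3 τ 0 * th4 τ 0) ^ 8 = K * etaF τ ^ 24 := by
  obtain ⟨f, hf⟩ := exists_cuspForm_levelOne (k := 12)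
    (F := fun τ ↦ (th2 τ 0 ^ 4 * th3 τ 0 ^ 4 * th4 τ 0 ^ 4) ^ 2)
    (fun τ hτ ↦ ((((differentiableAt_th2_zero hτ).pow 4).mul
      ((differentiableAt_th3_zero hτ).pow 4)).mul
      ((differentiableAt_th4_zero hτ).pow 4)).pow 2 |>.differentiableWithinAt)
    (fun τ hτ ↦ by
      rw [th2_zero_add_one_pow_four hτ, th3_zero_add_one, th4_zero_add_one]
      ring)
    (fun τ hτ ↦ by
      rw [th2_zero_S_pow_four hτ, th3_zero_S_pow_four hτ, th4_zero_S_pow_four hτ]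
      ring)
    (by simpa using ((tendsto_th2_pow_four_imInfty.mul (tendsto_th3_imInfty.pow 4)).mul
      (tendsto_th4_imInfty.pow 4)).pow 2)
  obtain ⟨K, hK⟩ := CuspForm.exists_smul_discriminant_of_weight_eq_twelve f
  refine ⟨K, fun τ hτ ↦ ?_⟩
  have h := hf ⟨τ, hτ⟩
  rw [← hK] at h
  rw [etaF_eq_eta]
  change K * ModularForm.eta τ ^ 24 = (th2 τ 0 ^ 4 * th3 τ 0 ^ 4 * th4 τ 0 ^ 4) ^ 2 at h
  rw [h]
  ring

/-- The product formula `(ϑ₂ϑ₃ϑ₄)(τ, 0)² = 4 η(τ)⁶`. -/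
theorem theta_prod_sq_eq {τ : ℂ} (hτ : 0 < τ.im) :
    (th2 τ 0 * th3 τ 0 * th4 τ 0) ^ 2 = 4 * etaF τ ^ 6 := by
  obtain ⟨K, hK⟩ := exists_theta_prod_pow_eq
  set F : ℂ → ℂ := fun τ ↦ (th2 τ 0 * th3 τ 0 * th4 τ 0) ^ 2 / etaF τ ^ 6 with hF
  have hF4 (τ : ℂ) (hτ : 0 < τ.im) : F τ ^ 4 = K := by
    have := etaF_ne_zero hτ
    rw [hF]
    field_simp
    linear_combination hK τ hτ
  have hlim : Tendsto F imInfty (𝓝 4) := by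
    have h := ((((tendsto_cexp_mul_th2_imInfty.mul tendsto_th3_imInfty).mul
      tendsto_th4_imInfty).pow 2).div (tendsto_cexp_mul_etaF_imInfty.pow 6) (by simp))
    norm_num at h
    refine h.congr fun τ ↦ ?_
    have he : cexp (-(Real.pi * Complex.I * τ / 4)) ^ 2 = cexp (-(twoPiI * τ / 24)) ^ 6 := by
      rw [← Complex.exp_nat_mul, ← Complex.exp_nat_mul]
      unfold twoPiI
      push_cast
      ring_nf
    have h0 := Complex.exp_ne_zero (-(twoPiI * τ / 24))
    rw [hF]
    simp only [Pi.div_apply, mul_pow, he]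
    rw [mul_assoc, mul_assoc, mul_div_mul_left _ _ (pow_ne_zero 6 h0), mul_assoc]
  have hK' : K = 256 := by
    have h1 : Tendsto (fun τ ↦ F τ ^ 4) imInfty (𝓝 K) := by
      refine tendsto_const_nhds.congr' ?_
      filter_upwards [eventually_one_le_im] with τ hτ
      rw [hF4 τ (by linarith)]
    rw [tendsto_nhds_unique h1 (hlim.pow 4)]
    norm_num
  have hd : DifferentiableOn ℂ F {τ | 0 < τ.im} := fun τ hτ ↦ by
    refine DifferentiableAt.differentiableWithinAt ?_
    have hη : DifferentiableAt ℂ etaF τ := by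
      rw [funext etaF_eq_eta]
      exact ModularForm.differentiableAt_eta_of_mem_upperHalfPlaneSet hτ
    exact ((((differentiableAt_th2_zero hτ).mul (differentiableAt_th3_zero hτ)).mul
      (differentiableAt_th4_zero hτ)).pow 2).div (hη.pow 6) (pow_ne_zero 6 (etaF_ne_zero hτ))
  have hF0 : ∀ τ : ℂ, 0 < τ.im → F τ - 4 = 0 := by
    refine (eqOn_zero_or_eqOn_zero_of_mul (g := fun τ ↦ (F τ + 4) * (F τ ^ 2 + 16))
      (hd.sub_const 4) ((hd.add_const 4).mul ((hd.pow 2).add_const 16)) fun τ hτ ↦ ?_).resolve_right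
      fun h ↦ ?_
    · linear_combination hF4 τ hτ + hK'
    · have h1 := (hlim.add_const 4).mul ((hlim.pow 2).add_const 16)
      have h2 : Tendsto (fun τ ↦ (F τ + 4) * (F τ ^ 2 + 16)) imInfty (𝓝 0) := by
        refine tendsto_const_nhds.congr' ?_
        filter_upwards [eventually_one_le_im] with τ hτ
        rw [h τ (by linarith)]
      have := tendsto_nhds_unique h1 h2
      norm_num at this
  have h := hF0 τ hτ
  have := etaF_ne_zero hτ
  rw [sub_eq_zero, hF] at h
  field_simp at h
  linear_combination h

/-! ### Fourth powers of theta constants and Eisenstein series -/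

theorem E2_add_two (τ : ℂ) : E2 (τ + 2) = E2 τ := by
  rw [← one_add_one_eq_two, ← add_assoc, E2_add_one, E2_add_one]

theorem E2_half_add_one_S {τ : ℂ} (hτ : 0 < τ.im) :
    E2 ((-1 / τ + 1) / 2) = τ ^ 2 * E2 ((τ + 1) / 2) + 12 / (Real.pi * Complex.I) * τ := by
  have h0 : τ ≠ 0 := by rintro rfl; simp at hτ
  have h1 : τ - 1 ≠ 0 := by
    intro h
    rw [sub_eq_zero.mp h] at hτ
    simp at hτ
  have hw : 0 < ((τ - 1) / 2).im := by simpa using hτ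
  have hY := im_neg_one_div_pos hw
  have hY2 : 0 < (-1 / ((τ - 1) / 2) - 2).im := by simpa using hY
  have e1 : (-1 / τ + 1) / 2 = -1 / (-1 / ((τ - 1) / 2) - 2) := by
    have : -1 / ((τ - 1) / 2) - 2 = -2 * τ / (τ - 1) := by
      field_simp
      ring
    rw [this]
    field_simp
    ring
  have e2 : E2 (-1 / ((τ - 1) / 2) - 2) = E2 (-1 / ((τ - 1) / 2)) := by
    rw [← E2_add_two, sub_add_cancel]
  have e3 : E2 ((τ - 1) / 2) = E2 ((τ + 1) / 2) := by
    rw [← E2_add_one]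
    congr 1
    ring
  rw [e1, E2_S hY2, e2, E2_S hw, e3]
  have := Real.pi_ne_zero
  field_simp
  ring

theorem th4_pow_four_sub_th2_pow_four {τ : ℂ} (hτ : 0 < τ.im) :
    2 * E2 τ - E2 ((τ + 1) / 2) = th4 τ 0 ^ 4 - th2 τ 0 ^ 4 := by
  set d2 : ℂ → ℂ := fun τ ↦ 2 * E2 τ - 4 * E2 (2 * τ) + th3 τ 0 ^ 4 + th4 τ 0 ^ 4 with hd2
  set d3 : ℂ → ℂ := fun τ ↦ 2 * E2 τ - E2 ((τ + 1) / 2) - (th4 τ 0 ^ 4 - th2 τ 0 ^ 4) with hd3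
  set d4 : ℂ → ℂ := fun τ ↦ 2 * E2 τ - E2 (τ / 2) - (th2 τ 0 ^ 4 + th3 τ 0 ^ 4) with hd4
  have T2 (τ : ℂ) : d2 (τ + 1) = d2 τ := by
    simp only [hd2, E2_add_one, th3_zero_add_one, th4_zero_add_one, mul_add, mul_one, E2_add_two]
    ring
  have T3 (τ : ℂ) (hτ : 0 < τ.im) : d3 (τ + 1) = d4 τ := by
    have : (τ + 1 + 1) / 2 = τ / 2 + 1 := by ring
    simp only [hd3, hd4, E2_add_one, th2_zero_add_one_pow_four hτ, th4_zero_add_one, this]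
    ring
  have T4 (τ : ℂ) (hτ : 0 < τ.im) : d4 (τ + 1) = d3 τ := by
    simp only [hd3, hd4, E2_add_one, th2_zero_add_one_pow_four hτ, th3_zero_add_one]
    ring
  have S2 (τ : ℂ) (hτ : 0 < τ.im) : d2 (-1 / τ) = τ ^ 2 * d4 τ := by
    have h0 : τ ≠ 0 := by rintro rfl; simp at hτ
    have e : 2 * (-1 / τ) = -1 / (τ / 2) := by field_simp
    simp only [hd2, hd4, th3_zero_S_pow_four hτ, th4_zero_S_pow_four hτ, E2_S hτ, e,
      E2_S (show 0 < (τ / 2).im by simpa using hτ)]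
    ring
  have S3 (τ : ℂ) (hτ : 0 < τ.im) : d3 (-1 / τ) = τ ^ 2 * d3 τ := by
    simp only [hd3, th2_zero_S_pow_four hτ, th4_zero_S_pow_four hτ, E2_S hτ, E2_half_add_one_S hτ]
    ring
  have S4 (τ : ℂ) (hτ : 0 < τ.im) : d4 (-1 / τ) = τ ^ 2 * d2 τ := by
    have h0 : τ ≠ 0 := by rintro rfl; simp at hτ
    have e : -1 / τ / 2 = -1 / (2 * τ) := by field_simp
    simp only [hd2, hd4, th2_zero_S_pow_four hτ, th3_zero_S_pow_four hτ, E2_S hτ, e,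
      E2_S (show 0 < (2 * τ).im by simpa using hτ)]
    ring
  have hE (f : ℂ → ℂ) (hf : Differentiable ℂ f) (hm : ∀ τ : ℂ, 0 < τ.im → 0 < (f τ).im) :
      DifferentiableOn ℂ (fun τ ↦ E2 (f τ)) {τ | 0 < τ.im} :=
    differentiableOn_E2.comp hf.differentiableOn hm
  have D2' : DifferentiableOn ℂ (fun τ ↦ th2 τ 0 ^ 4) {τ | 0 < τ.im} :=
    fun τ hτ ↦ ((differentiableAt_th2_zero hτ).pow 4).differentiableWithinAt
  have D3' : DifferentiableOn ℂ (fun τ ↦ th3 τ 0 ^ 4) {τ | 0 < τ.im} :=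
    fun τ hτ ↦ ((differentiableAt_th3_zero hτ).pow 4).differentiableWithinAt
  have D4' : DifferentiableOn ℂ (fun τ ↦ th4 τ 0 ^ 4) {τ | 0 < τ.im} :=
    fun τ hτ ↦ ((differentiableAt_th4_zero hτ).pow 4).differentiableWithinAt
  have D2 : DifferentiableOn ℂ d2 {τ | 0 < τ.im} :=
    (((differentiableOn_E2.const_mul 2).sub
      ((hE (fun τ ↦ 2 * τ) (by fun_prop) (by simp)).const_mul 4)).add D3').add D4'
  have D3 : DifferentiableOn ℂ d3 {τ | 0 < τ.im} :=
    ((differentiableOn_E2.const_mul 2).sub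
      (hE (fun τ ↦ (τ + 1) / 2) (by fun_prop) (by simp))).sub (D4'.sub D2')
  have D4 : DifferentiableOn ℂ d4 {τ | 0 < τ.im} :=
    ((differentiableOn_E2.const_mul 2).sub
      (hE (fun τ ↦ τ / 2) (by fun_prop) (by simp))).sub (D2'.add D3')
  have L2 : Tendsto d2 imInfty (𝓝 0) := by
    have h := ((((tendsto_E2_imInfty.const_mul 2).sub
      ((tendsto_E2_imInfty.comp tendsto_two_mul_imInfty).const_mul 4)).add
      (tendsto_th3_imInfty.pow 4)).add (tendsto_th4_imInfty.pow 4))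
    norm_num at h
    exact h
  have L3 : Tendsto d3 imInfty (𝓝 0) := by
    have h := (((tendsto_E2_imInfty.const_mul 2).sub
      (tendsto_E2_imInfty.comp (tendsto_div_two_imInfty.comp tendsto_add_one_imInfty))).sub
      ((tendsto_th4_imInfty.pow 4).sub tendsto_th2_pow_four_imInfty))
    norm_num at h
    exact h
  have L4 : Tendsto d4 imInfty (𝓝 0) := by
    have h := (((tendsto_E2_imInfty.const_mul 2).sub
      (tendsto_E2_imInfty.comp tendsto_div_two_imInfty)).sub
      (tendsto_th2_pow_four_imInfty.add (tendsto_th3_imInfty.pow 4)))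
    norm_num at h
    exact h
  obtain ⟨f, hf⟩ := exists_cuspForm_levelOne (k := 6) (F := fun τ ↦ d3 τ * (d2 τ * d4 τ))
    (D3.mul (D2.mul D4))
    (fun τ hτ ↦ by
      rw [T2, T3 τ hτ, T4 τ hτ]
      ring)
    (fun τ hτ ↦ by
      rw [S2 τ hτ, S3 τ hτ, S4 τ hτ]
      ring)
    (by simpa using L3.mul (L2.mul L4))
  have hf0 : f = 0 := rank_zero_iff_forall_zero.mp
    (CuspForm.rank_eq_zero_of_weight_lt_twelve (k := (6 : ℕ)) (by norm_num)) f
  have hprod (τ : ℂ) (hτ : 0 < τ.im) : d3 τ * (d2 τ * d4 τ) = 0 := by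
    have h := hf ⟨τ, hτ⟩
    rw [hf0] at h
    exact h.symm
  rw [← sub_eq_zero]
  change d3 τ = 0
  have of_d4 (h : ∀ τ : ℂ, 0 < τ.im → d4 τ = 0) : d3 τ = 0 := by
    rw [← T4 τ hτ]
    exact h _ (by simpa using hτ)
  rcases eqOn_zero_or_eqOn_zero_of_mul D3 (D2.mul D4) hprod with h | h
  · exact h τ hτ
  rcases eqOn_zero_or_eqOn_zero_of_mul D2 D4 h with h | h
  · refine of_d4 fun τ hτ ↦ ?_
    have h0 : τ ≠ 0 := by rintro rfl; simp at hτ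
    have h1 := S2 τ hτ
    rw [h _ (im_neg_one_div_pos hτ)] at h1
    simpa [h0] using h1.symm
  · exact of_d4 h

theorem Lam_two_half_add_half {τ : ℂ} (hτ : 0 < τ.im) :
    Lam 2 (τ / 2 + 1 / 2) = (th4 τ 0 ^ 4 - th2 τ 0 ^ 4) / 12 := by
  rw [← th4_pow_four_sub_th2_pow_four hτ, Lam, ← add_div, Nat.cast_ofNat,
    mul_div_cancel₀ _ two_ne_zero, E2_add_one]
  ring

end Auxiliary

/-- `(1/12)·φ_{0,1}(τ,z) − Λ₂(τ/2 + 1/2)·φ_{-2,1}(τ,z) = ϑ₃(τ,z)²/ϑ₃(τ,0)²`. -/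
theorem theta3_identity :
    ∀ τ z : ℂ, 0 < τ.im →
      1 / 12 * phi01 τ z - Lam 2 (τ / 2 + 1 / 2) * phim21 τ z = th3 τ z ^ 2 / th3 τ 0 ^ 2 := by
  intro τ z hτ
  have hη := theta_prod_sq_eq hτ
  have h : th2 τ 0 * th3 τ 0 * th4 τ 0 ≠ 0 := by
    intro h
    rw [h] at hη
    simp [etaF_ne_zero hτ] at hη
  rw [mul_ne_zero_iff, mul_ne_zero_iff] at h
  exact theta3_identity_of_theta_constants hτ z h.1.1 h.1.2 h.2 (Lam_two_half_add_half hτ) hη
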